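/- Let G be a finitely generated virtually abelian group with finite generating set S, let N ⊴_fin G be a torsion-free abelian normal subgroup of finite index, and let φ ∈ End(G) satisfy φ(N) ⊆ N. Suppose moreover that G/N is abelian and the endomorphism φ̄ induced by φ on G/N is the identity. Then for any g_0 ∈ G, the twisted conjugacy class growth satisfies β_{[g_0]_φ ⊂ G}^S(r) = Θ(r^{rank(Id_N − (τ_{g_0} ∘ φ)|_N)}) as r → ∞. -/

import Mathlib

open Filter Topology
open scoped Pointwise NNReal

/-- The ball of radius `r` in a group `G` with respect to a generating set `S`:
elements expressible as a product of at most `r` elements of `S ∪ S⁻¹`. -/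
def ball {G : Type*} [Group G] (S : Set G) (r : ℕ) : Set G :=
  {g | ∃ l : List G, l.length ≤ r ∧ (∀ x ∈ l, x ∈ S ∪ S⁻¹) ∧ l.prod = g}

/-- `x` and `y` are `φ`-twisted conjugate: `∃ z, x = z * y * (φ z)⁻¹`. -/
def TwistedConj {G : Type*} [Group G] (φ : G →* G) (x y : G) : Prop :=
  ∃ z : G, x = z * y * (φ z)⁻¹

/-- The `φ`-twisted conjugacy class of `g`. -/
def twistedConjClass {G : Type*} [Group G] (φ : G →* G) (g : G) : Set G :=
  {x | TwistedConj φ x g}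

/-- `f = Θ(g)` as `r → ∞`: there are `c₁, c₂ > 0` and `n₀ ∈ ℕ_{>0}` with
`c₁ g(r) ≤ f(r) ≤ c₂ g(r)` for all `r ≥ n₀`. -/
def IsThetaNat (f g : ℕ → ℕ) : Prop :=
  ∃ c₁ c₂ : ℝ, 0 < c₁ ∧ 0 < c₂ ∧ ∃ n₀ : ℕ, 0 < n₀ ∧
    ∀ r : ℕ, n₀ ≤ r → c₁ * (g r : ℝ) ≤ (f r : ℝ) ∧ (f r : ℝ) ≤ c₂ * (g r : ℝ)

/-- The rank of a subgroup `H` of `G`: the largest `n` such that the free abelian group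
`ℤⁿ` embeds into `H`. For a finitely generated free abelian group this is its rank. -/
noncomputable def grpRank {G : Type*} [Group G] (H : Subgroup G) : ℕ :=
  sSup {n : ℕ | ∃ f : Multiplicative (Fin n → ℤ) →* G, Function.Injective f ∧ ∀ v, f v ∈ H}

/-- The image of the endomorphism `Id_N - (τ_g ∘ φ)|_N` of `N`, written multiplicatively:
the subgroup generated by `{x * (g * φ x * g⁻¹)⁻¹ : x ∈ N}` (this set is already a subgroup
when `N` is abelian, normal and `φ`-invariant). -/
def twistImage {G : Type*} [Group G] (φ : G →* G) (N : Subgroup G) (g : G) : Subgroup G :=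
  Subgroup.closure {y | ∃ x ∈ N, y = x * (g * φ x * g⁻¹)⁻¹}

/-- The minimum over the cosets `gN ∈ G/N` of `rank(Id_N - (τ_g ∘ φ)|_N)`. -/
noncomputable def minTwistRank {G : Type*} [Group G] (φ : G →* G) (N : Subgroup G) : ℕ :=
  sInf {m : ℕ | ∃ g : G, m = grpRank (twistImage φ N g)}

/-- The subset growth of `U` in `G` with respect to `S`: `#(U ∩ B_G^S(r))`. -/
noncomputable def subsetGrowth {G : Type*} [Group G] (U : Set G) (S : Set G) (r : ℕ) : ℕ :=
  Nat.card ↥(U ∩ ball S r)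

section Ball

variable {G : Type*} [Group G] {S : Set G}

lemma ball_mono {r s : ℕ} (h : r ≤ s) : ball S r ⊆ ball S s := by
  rintro g ⟨l, hl, hS, rfl⟩
  exact ⟨l, hl.trans h, hS, rfl⟩

lemma one_mem_ball (r : ℕ) : (1 : G) ∈ ball S r := ⟨[], by simp, by simp, rfl⟩

lemma mul_mem_ball {r s : ℕ} {g h : G} (hg : g ∈ ball S r) (hh : h ∈ ball S s) :
    g * h ∈ ball S (r + s) := by
  obtain ⟨l, hl, hlS, rfl⟩ := hg
  obtain ⟨m, hm, hmS, rfl⟩ := hh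
  refine ⟨l ++ m, by simp; omega, ?_, by simp⟩
  intro x hx
  rcases List.mem_append.1 hx with hx | hx
  exacts [hlS x hx, hmS x hx]

lemma npow_mem_ball {r : ℕ} {g : G} (hg : g ∈ ball S r) (n : ℕ) : g ^ n ∈ ball S (n * r) := by
  induction n with
  | zero => simpa using one_mem_ball 0
  | succ n ih =>
    rw [pow_succ, Nat.succ_mul]
    exact mul_mem_ball ih hg

lemma exists_mem_ball (hS : Subgroup.closure S = ⊤) (g : G) : ∃ r, g ∈ ball S r := by
  have hg : g ∈ (Subgroup.closure S).toSubmonoid := by simp [hS]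
  rw [Subgroup.closure_toSubmonoid] at hg
  obtain ⟨l, hl, rfl⟩ := Submonoid.exists_list_of_mem_closure hg
  exact ⟨l.length, l, le_rfl, hl, rfl⟩

lemma exists_forall_mem_ball (hS : Subgroup.closure S = ⊤) {ι : Type*} [Finite ι] (u : ι → G) :
    ∃ L, ∀ i, u i ∈ ball S L := by
  cases nonempty_fintype ι
  choose r hr using fun i => exists_mem_ball hS (u i)
  exact ⟨Finset.univ.sup r, fun i => ball_mono (Finset.le_sup (Finset.mem_univ i)) (hr i)⟩

end Ball

/-- A submodule `J` of a finite free `ℤ`-module has a finite basis, and some tuple of as many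
linear forms separates the points of `J`. -/
lemma exists_basis_and_separating_forms {A : Type*} [AddCommGroup A] [Module.Finite ℤ A]
    [IsAddTorsionFree A] (J : Submodule ℤ A) :
    ∃ (k : ℕ) (f : (Fin k → ℤ) →ₗ[ℤ] A) (p : A →ₗ[ℤ] (Fin k → ℤ)),
      Function.Injective f ∧ LinearMap.range f = J ∧ ∀ x ∈ J, p x = 0 → x = 0 := by
  obtain ⟨k, snf⟩ := J.smithNormalForm (Module.Free.chooseBasis ℤ A)
  refine ⟨k, J.subtype ∘ₗ snf.bN.equivFun.symm.toLinearMap,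
    LinearMap.pi fun i => snf.bM.coord (snf.f i), ?_, ?_, ?_⟩
  · exact J.subtype_injective.comp snf.bN.equivFun.symm.injective
  · rw [LinearMap.range_comp, LinearEquiv.range, Submodule.map_top, Submodule.range_subtype]
  · intro x hx h
    refine snf.bM.ext_elem fun i => ?_
    rw [map_zero, Finsupp.zero_apply]
    by_cases hi : i ∈ Set.range snf.f
    · obtain ⟨j, rfl⟩ := hi
      exact congrFun h j
    · exact snf.repr_eq_zero_of_notMem_range ⟨x, hx⟩ hi

/-- The multiplicative form of `exists_basis_and_separating_forms`, for a subgroup of a finitely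
generated torsion-free abelian subgroup. -/
lemma exists_embedding_and_separating_hom {G : Type*} [Group G] (N I : Subgroup G)
    (hfg : Group.FG N) (hIN : I ≤ N)
    (hNab : ∀ x ∈ N, ∀ y ∈ N, x * y = y * x)
    (hNtf : ∀ x ∈ N, ∀ k : ℕ, 0 < k → x ^ k = 1 → x = 1) :
    ∃ (k : ℕ) (f : Multiplicative (Fin k → ℤ) →* G) (p : N →* Multiplicative (Fin k → ℤ)),
      Function.Injective f ∧ f.range = I ∧ ∀ x : N, (x : G) ∈ I → p x = 1 → x = 1 := by
  let _ : CommGroup N :=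
    { (inferInstance : Group N) with
      mul_comm := fun x y => Subtype.ext (hNab x x.2 y y.2) }
  have : IsMulTorsionFree N := by
    refine ⟨fun n hn x y hxy => ?_⟩
    have h : (x * y⁻¹) ^ n = 1 := by
      rw [mul_pow, inv_pow, mul_inv_eq_one]
      exact hxy
    have h1 := hNtf _ (x * y⁻¹).2 n (Nat.pos_of_ne_zero hn) (by exact_mod_cast h)
    exact mul_inv_eq_one.1 (Subtype.ext h1)
  have : Module.Finite ℤ (Additive N) := Module.Finite.iff_addGroup_fg.2 inferInstance
  obtain ⟨k, f, p, hf, hrange, hp⟩ := exists_basis_and_separating_forms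
    (AddSubgroup.toIntSubmodule (Subgroup.toAddSubgroup (I.subgroupOf N)))
  have hmem (x : N) : (x : G) ∈ I ↔ ∃ v, f v = Additive.ofMul x := by
    rw [← LinearMap.mem_range, hrange]
    rfl
  refine ⟨k, N.subtype.comp (AddMonoidHom.toMultiplicativeLeft f.toAddMonoidHom),
    AddMonoidHom.toMultiplicativeRight p.toAddMonoidHom, ?_, ?_, ?_⟩
  · exact N.subtype_injective.comp hf
  · ext g
    constructor
    · rintro ⟨v, rfl⟩
      exact (hmem _).2 ⟨v.toAdd, rfl⟩
    · intro hg
      obtain ⟨v, hv⟩ := (hmem ⟨g, hIN hg⟩).1 hg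
      exact ⟨Multiplicative.ofAdd v, congrArg (fun a : Additive N => (a.toMul : G)) hv⟩
  · intro x hx h
    exact hp (Additive.ofMul x) hx h

lemma grpRank_range {G : Type*} [Group G] {k : ℕ} (f : Multiplicative (Fin k → ℤ) →* G)
    (hf : Function.Injective f) : grpRank f.range = k := by
  refine IsGreatest.csSup_eq ⟨⟨f, hf, fun v => ⟨v, rfl⟩⟩, ?_⟩
  rintro n ⟨h, hh, hmem⟩
  let u : Multiplicative (Fin n → ℤ) →* Multiplicative (Fin k → ℤ) :=
    (MonoidHom.ofInjective hf).symm.toMonoidHom.comp (h.codRestrict f.range hmem)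
  have hu : Function.Injective u :=
    (MonoidHom.ofInjective hf).symm.injective.comp fun a b hab => hh (congrArg Subtype.val hab)
  let w : (Fin n → ℤ) →+ (Fin k → ℤ) := MonoidHom.toAdditive u
  have hw : Function.Injective w.toIntLinearMap := hu
  simpa using LinearMap.finrank_le_finrank_of_injective hw

/-- Coordinates on a finite index abelian normal subgroup are bounded linearly in the word length
of the ambient group. -/
lemma exists_coord_bound {G : Type*} [Group G] {S : Set G} (hS : S.Finite) (N : Subgroup G)
    [N.Normal] [N.FiniteIndex] (hNab : ∀ x ∈ N, ∀ y ∈ N, x * y = y * x) {k : ℕ}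
    (p : N →* Multiplicative (Fin k → ℤ)) :
    ∃ C : ℕ, ∀ r, ∀ x : N, (x : G) ∈ ball S r → ∀ i, |(p x).toAdd i| ≤ C * r := by
  have hc (q : G ⧸ N) (g : G) : q.out * g * (q * (g : G ⧸ N)).out⁻¹ ∈ N := by
    rw [← QuotientGroup.eq_one_iff]
    simp
  let c (q : G ⧸ N) (g : G) : N := ⟨q.out * g * (q * (g : G ⧸ N)).out⁻¹, hc q g⟩
  have hone (q : G ⧸ N) : c q 1 = 1 := Subtype.ext (by simp [c])
  have hmul (q : G ⧸ N) (g h : G) : c q (g * h) = c q g * c (q * (g : G ⧸ N)) h :=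
    Subtype.ext (by simp [c, mul_assoc])
  have : Finite ↥(S ∪ S⁻¹) := (hS.union hS.inv).to_subtype
  obtain ⟨C, hC⟩ : ∃ C : ℕ, ∀ (q : G ⧸ N) (s : ↥(S ∪ S⁻¹)) (i : Fin k),
      ((p (c q s)).toAdd i).natAbs ≤ C := by
    have hfin := Set.finite_range fun t : (G ⧸ N) × ↥(S ∪ S⁻¹) × Fin k =>
      ((p (c t.1 t.2.1)).toAdd t.2.2).natAbs
    obtain ⟨C, hC⟩ := hfin.bddAbove
    exact ⟨C, fun q s i => hC ⟨(q, s, i), rfl⟩⟩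
  have hlist (l : List G) (hl : ∀ x ∈ l, x ∈ S ∪ S⁻¹) (q : G ⧸ N) (i : Fin k) :
      |(p (c q l.prod)).toAdd i| ≤ C * l.length := by
    induction l generalizing q with
    | nil => simp [hone]
    | cons s l ih =>
      have h1 := ih (fun x hx => hl x (List.mem_cons_of_mem s hx)) (q * (s : G ⧸ N))
      have h2 := hC q ⟨s, hl s List.mem_cons_self⟩ i
      rw [List.prod_cons, hmul, map_mul, toAdd_mul, Pi.add_apply, List.length_cons]
      refine (abs_add_le _ _).trans ?_
      have h3 : |(p (c q s)).toAdd i| ≤ C := by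
        rw [Int.abs_eq_natAbs]
        exact_mod_cast h2
      push_cast
      linarith
  refine ⟨C, fun r x hx i => ?_⟩
  obtain ⟨l, hl, hlS, hprod⟩ := hx
  have hout : (1 : G ⧸ N).out ∈ N := by
    rw [← QuotientGroup.eq_one_iff]
    simp
  have hcx : c 1 l.prod = x := by
    refine Subtype.ext ?_
    have hxq : ((x : G) : G ⧸ N) = 1 := (QuotientGroup.eq_one_iff _).2 x.2
    simp only [c, hprod, hxq, mul_one]
    rw [hNab _ hout _ x.2, mul_inv_cancel_right]
  rw [← hcx]
  refine (hlist l hlS 1 i).trans ?_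
  gcongr

/-- The image of a vector with natural number entries at most `m` has word length at most
`k * (m * L)`, if the images of the standard basis have word length at most `L`. -/
lemma map_nat_vector_mem_ball {G : Type*} [Group G] {S : Set G} {k L : ℕ}
    (f : Multiplicative (Fin k → ℤ) →* G)
    (hL : ∀ i, f (Multiplicative.ofAdd (Pi.single i 1)) ∈ ball S L) (m : ℕ)
    (v : Fin k → ℕ) (hv : ∀ i, v i ≤ m) :
    f (Multiplicative.ofAdd fun i => (v i : ℤ)) ∈ ball S (k * (m * L)) := by
  have hpartial (s : Finset (Fin k)) :
      f (Multiplicative.ofAdd (∑ i ∈ s, v i • Pi.single i 1)) ∈ ball S (s.card * (m * L)) := by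
    induction s using Finset.induction_on with
    | empty => simpa using one_mem_ball 0
    | insert a s ha ih =>
      rw [Finset.sum_insert ha, Finset.card_insert_of_notMem ha, ofAdd_add, map_mul, ofAdd_nsmul,
        map_pow, add_mul, one_mul, add_comm]
      refine mul_mem_ball (ball_mono ?_ (npow_mem_ball (hL a) (v a))) ih
      exact Nat.mul_le_mul_right L (hv a)
  have hsum : (fun i => (v i : ℤ)) = ∑ i, v i • (Pi.single i 1 : Fin k → ℤ) := by
    ext j
    simp [Finset.sum_apply, Pi.single_apply]
  rw [hsum]
  simpa using hpartial Finset.univ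

/-- A set lying between a coset of a subgroup `I` and a finite union of cosets of `I` grows like
`r ^ rank I`, if `I` lies in a finite index torsion-free abelian normal subgroup. -/
lemma isThetaNat_subsetGrowth_of_cosets {G : Type*} [Group G]
    {S : Set G} (hSfin : S.Finite) (hSgen : Subgroup.closure S = ⊤)
    (N : Subgroup G) [N.Normal] [N.FiniteIndex]
    (hNab : ∀ x ∈ N, ∀ y ∈ N, x * y = y * x)
    (hNtf : ∀ x ∈ N, ∀ k : ℕ, 0 < k → x ^ k = 1 → x = 1)
    (I : Subgroup G) (hIN : I ≤ N) (U : Set G) (g₀ : G) (hlow : ∀ y ∈ I, y * g₀ ∈ U)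
    {ι : Type*} [Finite ι] (t : ι → G) (hup : ∀ x ∈ U, ∃ j, x * (t j)⁻¹ ∈ I) :
    IsThetaNat (subsetGrowth U S) (fun r => r ^ grpRank I) := by
  have : Group.FG G := Group.fg_iff.2 ⟨S, hSgen, hSfin⟩
  obtain ⟨k, f, p, hf, rfl, hp⟩ :=
    exists_embedding_and_separating_hom N I inferInstance hIN hNab hNtf
  rw [grpRank_range f hf]
  obtain ⟨C, hC⟩ := exists_coord_bound hSfin N hNab p
  obtain ⟨M, hM⟩ := exists_forall_mem_ball hSgen fun j => (t j)⁻¹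
  obtain ⟨L₁, hL₁⟩ := exists_forall_mem_ball hSgen
    fun i : Fin k => f (Multiplicative.ofAdd (Pi.single i 1))
  obtain ⟨L₂, hL₂⟩ := exists_mem_ball hSgen g₀
  obtain ⟨L, hL, hL₁L, hL₂L⟩ : ∃ L, 0 < L ∧ L₁ ≤ L ∧ L₂ ≤ L :=
    ⟨L₁ + L₂ + 1, by omega, by omega, by omega⟩
  have : Nonempty ι := ⟨(hup _ (hlow 1 (Subgroup.one_mem _))).choose⟩
  choose! j hj using hup
  have hbound (r : ℕ) (x : ↥(U ∩ ball S r)) (i : Fin k) :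
      (p ⟨x * (t (j x))⁻¹, hIN (hj x x.2.1)⟩).toAdd i ∈
        Finset.Icc (-(C * (r + M) : ℤ)) (C * (r + M)) := by
    rw [Finset.mem_Icc, ← abs_le]
    exact_mod_cast hC (r + M) ⟨x * (t (j x))⁻¹, hIN (hj x x.2.1)⟩ (mul_mem_ball x.2.2 (hM _)) i
  let F (r : ℕ) (x : ↥(U ∩ ball S r)) :
      ι × (Fin k → Finset.Icc (-(C * (r + M) : ℤ)) (C * (r + M))) :=
    (j x, fun i => ⟨_, hbound r x i⟩)
  have hF (r : ℕ) : Function.Injective (F r) := by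
    intro x y hxy
    obtain ⟨h1, h2⟩ := Prod.ext_iff.1 hxy
    have h3 : p ⟨x * (t (j x))⁻¹, hIN (hj x x.2.1)⟩ = p ⟨y * (t (j y))⁻¹, hIN (hj y y.2.1)⟩ := by
      refine Multiplicative.toAdd.injective (funext fun i => ?_)
      exact congrArg Subtype.val (congrFun h2 i)
    have h4 := hp (⟨x * (t (j x))⁻¹, hIN (hj x x.2.1)⟩ / ⟨y * (t (j y))⁻¹, hIN (hj y y.2.1)⟩)
      (f.range.div_mem (hj x x.2.1) (hj y y.2.1)) (by rw [map_div, h3, div_self'])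
    have h5 : (x : G) * (t (j x))⁻¹ = y * (t (j y))⁻¹ := congrArg Subtype.val (div_eq_one.1 h4)
    have h1' : j x = j y := h1
    rw [h1'] at h5
    exact Subtype.ext (mul_right_cancel h5)
  have hupper (r : ℕ) : subsetGrowth U S r ≤ Nat.card ι * (2 * (C * (r + M)) + 1) ^ k := by
    refine (Nat.card_le_card_of_injective _ (hF r)).trans (le_of_eq ?_)
    rw [Nat.card_prod, Nat.card_pi]
    simp only [Nat.card_eq_fintype_card, Fintype.card_coe, Int.card_Icc, Finset.prod_const,
      Finset.card_univ, Fintype.card_fin]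
    congr 2
    have : (C * (r + M) + 1 - -(C * (r + M)) : ℤ) = ((2 * (C * (r + M)) + 1 : ℕ) : ℤ) := by
      push_cast
      ring
    rw [this, Int.toNat_natCast]
  have hlower (m r : ℕ) (h : k * (m * L) + L ≤ r) : (m + 1) ^ k ≤ subsetGrowth U S r := by
    have : Finite ↥(U ∩ ball S r) := Finite.of_injective _ (hF r)
    let E (v : Fin k → Fin (m + 1)) : ↥(U ∩ ball S r) :=
      ⟨f (Multiplicative.ofAdd fun i => ((v i : ℕ) : ℤ)) * g₀, hlow _ ⟨_, rfl⟩,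
        ball_mono h (mul_mem_ball
          (map_nat_vector_mem_ball f (fun i => ball_mono hL₁L (hL₁ i)) m (fun i => v i)
            fun i => Nat.le_of_lt_succ (v i).2) (ball_mono hL₂L hL₂))⟩
    have hE : Function.Injective E := by
      intro v w hvw
      have h1 := hf (mul_right_cancel (congrArg Subtype.val hvw))
      refine funext fun i => Fin.ext ?_
      exact_mod_cast congrFun (Multiplicative.ofAdd.injective h1) i
    simpa [subsetGrowth] using Nat.card_le_card_of_injective E hE
  have hLk : (0 : ℝ) < L * (k + 1) := by positivity
  refine ⟨(1 / (L * (k + 1))) ^ k, (Nat.card ι + 1) * (2 * C * (1 + M) + 1) ^ k,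
    by positivity, by positivity, L * (k + 1), by positivity, fun r hr => ⟨?_, ?_⟩⟩
  · have hm : 1 ≤ r / (L * (k + 1)) := (Nat.one_le_div_iff (by positivity)).2 hr
    have hdiv : L * (k + 1) * (r / (L * (k + 1))) ≤ r := Nat.mul_div_le _ _
    have hle := hlower (r / (L * (k + 1))) r (by nlinarith)
    have hlt : (r : ℝ) / (L * (k + 1)) ≤ (r / (L * (k + 1)) : ℕ) + 1 := by
      rw [div_le_iff₀ hLk]
      have := (Nat.lt_mul_div_succ r (show 0 < L * (k + 1) by positivity)).le
      rw [mul_comm]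
      exact_mod_cast this
    calc (1 / (L * (k + 1)) : ℝ) ^ k * ((r ^ k : ℕ) : ℝ) = ((r : ℝ) / (L * (k + 1))) ^ k := by
          push_cast
          rw [← mul_pow, one_div_mul_eq_div]
      _ ≤ ((r / (L * (k + 1)) : ℕ) + 1 : ℝ) ^ k := by gcongr
      _ ≤ subsetGrowth U S r := by exact_mod_cast hle
  · have hr1 : (1 : ℝ) ≤ r := by
      exact_mod_cast (show 0 < L * (k + 1) by positivity).trans_le hr
    have hCM : (0 : ℝ) ≤ 2 * C * M := by positivity
    calc (subsetGrowth U S r : ℝ) ≤ Nat.card ι * (2 * (C * (r + M)) + 1) ^ k := by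
          exact_mod_cast hupper r
      _ ≤ (Nat.card ι + 1) * ((2 * C * (1 + M) + 1) * r) ^ k := by
          gcongr
          · linarith
          · nlinarith
      _ = (Nat.card ι + 1) * (2 * C * (1 + M) + 1) ^ k * ((r ^ k : ℕ) : ℝ) := by
          push_cast
          rw [mul_pow, ← mul_assoc]

lemma mem_twistImage_iff {G : Type*} [Group G] {N : Subgroup G} [N.Normal]
    (hNab : ∀ x ∈ N, ∀ y ∈ N, x * y = y * x) {φ : G →* G} (hφN : ∀ x ∈ N, φ x ∈ N) {g y : G} :
    y ∈ twistImage φ N g ↔ ∃ x ∈ N, y = x * (g * φ x * g⁻¹)⁻¹ := by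
  refine ⟨fun h => ?_, fun h => Subgroup.subset_closure h⟩
  have hψ (x : G) (hx : x ∈ N) : (g * φ x * g⁻¹)⁻¹ ∈ N :=
    N.inv_mem (Subgroup.Normal.conj_mem inferInstance _ (hφN x hx) g)
  induction h using Subgroup.closure_induction with
  | mem y hy => exact hy
  | one => exact ⟨1, N.one_mem, by simp⟩
  | mul a b _ _ ha hb =>
    obtain ⟨x, hx, rfl⟩ := ha
    obtain ⟨y, hy, rfl⟩ := hb
    refine ⟨x * y, N.mul_mem hx hy, ?_⟩
    have h1 : (g * φ (x * y) * g⁻¹)⁻¹ = (g * φ y * g⁻¹)⁻¹ * (g * φ x * g⁻¹)⁻¹ := by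
      simp [mul_assoc]
    rw [h1, mul_assoc x, hNab _ (hψ x hx) _ (N.mul_mem hy (hψ y hy))]
    simp only [mul_assoc]
  | inv a _ ha =>
    obtain ⟨x, hx, rfl⟩ := ha
    refine ⟨x⁻¹, N.inv_mem hx, ?_⟩
    rw [mul_inv_rev, hNab _ (N.inv_mem (hψ x hx)) _ (N.inv_mem hx)]
    simp [mul_assoc]

/-- **Twisted conjugacy class growth when `G/N` is abelian and `φ̄ = Id`.** -/
theorem twisted_conjugacy_class_growth_abelian_quotient {G : Type*} [Group G]
    (S : Set G) (hSfin : S.Finite) (hSgen : Subgroup.closure S = ⊤)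
    (N : Subgroup G) (hNnorm : N.Normal) (hNfin : N.FiniteIndex)
    (hNab : ∀ x ∈ N, ∀ y ∈ N, x * y = y * x)
    (hNtf : ∀ x ∈ N, ∀ k : ℕ, 0 < k → x ^ k = 1 → x = 1)
    (φ : G →* G) (hφN : ∀ x ∈ N, φ x ∈ N)
    (hGNab : ∀ g h : G, g * h * g⁻¹ * h⁻¹ ∈ N)
    (hφbar : ∀ g : G, g⁻¹ * φ g ∈ N)
    (g₀ : G) :
    IsThetaNat (subsetGrowth (twistedConjClass φ g₀) S)
      (fun r => r ^ grpRank (twistImage φ N g₀)) := by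
  have hI {y : G} := mem_twistImage_iff hNab hφN (g := g₀) (y := y)
  refine isThetaNat_subsetGrowth_of_cosets hSfin hSgen N hNab hNtf (twistImage φ N g₀) ?_ _ g₀ ?_
    (fun q : G ⧸ N => q.out * g₀ * (φ q.out)⁻¹) ?_
  · intro y hy
    obtain ⟨x, hx, rfl⟩ := hI.1 hy
    exact N.mul_mem hx (N.inv_mem (hNnorm.conj_mem _ (hφN x hx) g₀))
  · intro y hy
    obtain ⟨x, hx, rfl⟩ := hI.1 hy
    exact ⟨x, by group⟩
  · rintro _ ⟨z, rfl⟩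
    refine ⟨(z : G ⧸ N), hI.2 ⟨z * (z : G ⧸ N).out⁻¹, ?_, ?_⟩⟩
    · rw [← QuotientGroup.eq_one_iff]
      simp
    · generalize hw : (z : G ⧸ N).out = w
      have hn : z * w⁻¹ ∈ N := by
        rw [← QuotientGroup.eq_one_iff]
        simp [← hw]
      have hd : w * g₀ * (φ w)⁻¹ * g₀⁻¹ ∈ N := by
        have h1 := N.mul_mem (hGNab w g₀)
          (hNnorm.conj_mem _ (N.inv_mem (hNnorm.conj_mem _ (hφbar w) w)) g₀)
        convert h1 using 1
        group
      obtain ⟨n, rfl⟩ : ∃ n, z = n * w := ⟨z * w⁻¹, by group⟩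
      rw [mul_inv_cancel_right] at hn ⊢
      have h2 := hNab _ hd _ (N.inv_mem (hNnorm.conj_mem _ (hφN n hn) g₀))
      calc n * w * g₀ * (φ (n * w))⁻¹ * (w * g₀ * (φ w)⁻¹)⁻¹
          = n * ((w * g₀ * (φ w)⁻¹ * g₀⁻¹) * (g₀ * φ n * g₀⁻¹)⁻¹) *
            (w * g₀ * (φ w)⁻¹ * g₀⁻¹)⁻¹ := by
            rw [map_mul]
            group
        _ = n * (g₀ * φ n * g₀⁻¹)⁻¹ := by
            rw [h2]
            group
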